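/- Let n ≥ 1, m ≥ 3, and let B_1, …, B_m be n×n complex Hermitian matrices. Then Σ_{r,s=1}^m ‖[B_r, B_s]‖² ≤ (4/3) (Σ_{r=1}^m ‖B_r‖²)². -/

import Mathlib

open Matrix

/-- Squared Frobenius norm of a complex matrix: `Re tr (A Aᴴ)`. -/
noncomputable def frobSq {n : ℕ} (A : Matrix (Fin n) (Fin n) ℂ) : ℝ :=
  ((A * Aᴴ).trace).re

/-- Commutator of matrices. -/
noncomputable def mcomm {n : ℕ} (A B : Matrix (Fin n) (Fin n) ℂ) : Matrix (Fin n) (Fin n) ℂ :=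
  A * B - B * A

theorem frobSq_eq_sum {n : ℕ} (A : Matrix (Fin n) (Fin n) ℂ) :
    frobSq A = ∑ i, ∑ j, ‖A i j‖ ^ 2 := by
  simp [frobSq, Matrix.trace, Matrix.mul_apply, Complex.mul_conj, Complex.normSq_eq_norm_sq,
    -Complex.ofReal_pow]

theorem frobSq_nonneg {n : ℕ} (A : Matrix (Fin n) (Fin n) ℂ) : 0 ≤ frobSq A := by
  rw [frobSq_eq_sum]; positivity

theorem norm_sq_le_frobSq {n : ℕ} (A : Matrix (Fin n) (Fin n) ℂ) (i j : Fin n) :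
    ‖A i j‖ ^ 2 ≤ frobSq A := by
  rw [frobSq_eq_sum]
  refine le_trans ?_ (Finset.single_le_sum (f := fun i => ∑ j, ‖A i j‖ ^ 2)
    (fun _ _ => by positivity) (Finset.mem_univ i))
  exact Finset.single_le_sum (f := fun j => ‖A i j‖ ^ 2)
    (fun _ _ => by positivity) (Finset.mem_univ j)

/-- The trace of `A Aᴴ` is real. -/
theorem trace_mul_conjTranspose_self {n : ℕ} (A : Matrix (Fin n) (Fin n) ℂ) :
    (A * Aᴴ).trace = (frobSq A : ℂ) := by
  rw [frobSq_eq_sum]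
  simp [Matrix.trace, Matrix.mul_apply, Complex.mul_conj, Complex.normSq_eq_norm_sq]

theorem two_mul_norm_sq_le_frobSq {n : ℕ} {A : Matrix (Fin n) (Fin n) ℂ} (hA : Aᴴ = A)
    {i j : Fin n} (hij : i ≠ j) : 2 * ‖A i j‖ ^ 2 ≤ frobSq A := by
  have hs : ‖A j i‖ = ‖A i j‖ := by
    conv_lhs => rw [← hA]
    simp
  rw [frobSq_eq_sum, ← Fintype.sum_prod_type' (f := fun i j => ‖A i j‖ ^ 2)]
  have h := Finset.sum_le_sum_of_subset_of_nonneg (f := fun e : Fin n × Fin n => ‖A e.1 e.2‖ ^ 2)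
    (Finset.subset_univ {(i, j), (j, i)}) (fun _ _ _ => by positivity)
  rw [Finset.sum_pair (by simp [hij])] at h
  simp only [hs] at h
  linarith

/-- An orthogonal change of basis preserves sums of squares. -/
theorem sum_sq_vecMul {m : ℕ} {O : Matrix (Fin m) (Fin m) ℝ} (hO : O * Oᵀ = 1)
    (x : Fin m → ℝ) : ∑ r, (∑ s, O s r * x s) ^ 2 = ∑ s, x s ^ 2 := by
  have h : (x ᵥ* O) ⬝ᵥ (x ᵥ* O) = x ⬝ᵥ x := by
    conv_lhs => rw [← mulVec_transpose O x, mulVec_transpose, ← dotProduct_mulVec,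
      ← mulVec_transpose O x, mulVec_mulVec, hO, one_mulVec]
  simpa [dotProduct, vecMul, pow_two, mul_comm] using h

theorem sum_frobSq_sum_smul {n m : ℕ} {O : Matrix (Fin m) (Fin m) ℝ} (hO : O * Oᵀ = 1)
    (V : Fin m → Matrix (Fin n) (Fin n) ℂ) :
    ∑ r, frobSq (∑ s, (O s r : ℂ) • V s) = ∑ s, frobSq (V s) := by
  have key : ∀ z : Fin m → ℂ, ∑ r, ‖∑ s, (O s r : ℂ) * z s‖ ^ 2 = ∑ s, ‖z s‖ ^ 2 := by
    intro z
    simp only [← Complex.normSq_eq_norm_sq, Complex.normSq_apply, Complex.re_sum, Complex.im_sum,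
      Complex.re_ofReal_mul, Complex.im_ofReal_mul, ← pow_two, Finset.sum_add_distrib,
      sum_sq_vecMul hO]
  simp only [frobSq_eq_sum]
  rw [Finset.sum_comm, Finset.sum_comm (s := Finset.univ (α := Fin m))]
  refine Finset.sum_congr rfl fun i _ => ?_
  rw [Finset.sum_comm, Finset.sum_comm (s := Finset.univ (α := Fin m))]
  refine Finset.sum_congr rfl fun j _ => ?_
  simpa [Matrix.sum_apply] using key fun s => V s i j

theorem mcomm_sum_smul_left {n m : ℕ} (c : Fin m → ℂ) (V : Fin m → Matrix (Fin n) (Fin n) ℂ)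
    (X : Matrix (Fin n) (Fin n) ℂ) :
    mcomm (∑ s, c s • V s) X = ∑ s, c s • mcomm (V s) X := by
  simp [mcomm, Finset.sum_mul, Finset.mul_sum, smul_sub]

theorem mcomm_sum_smul_right {n m : ℕ} (c : Fin m → ℂ) (V : Fin m → Matrix (Fin n) (Fin n) ℂ)
    (X : Matrix (Fin n) (Fin n) ℂ) :
    mcomm X (∑ s, c s • V s) = ∑ s, c s • mcomm X (V s) := by
  simp [mcomm, Finset.sum_mul, Finset.mul_sum, smul_sub]

theorem sum_frobSq_mcomm_sum_smul {n m : ℕ} {O : Matrix (Fin m) (Fin m) ℝ} (hO : O * Oᵀ = 1)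
    (V : Fin m → Matrix (Fin n) (Fin n) ℂ) :
    ∑ r, ∑ t, frobSq (mcomm (∑ s, (O s r : ℂ) • V s) (∑ s, (O s t : ℂ) • V s)) =
      ∑ r, ∑ t, frobSq (mcomm (V r) (V t)) := by
  simp only [mcomm_sum_smul_right _ V, sum_frobSq_sum_smul hO]
  rw [Finset.sum_comm]
  simp only [mcomm_sum_smul_left _ V, sum_frobSq_sum_smul hO]
  rw [Finset.sum_comm]

/-- A finite family of Hermitian matrices becomes orthogonal for the trace form after a suitable
real orthogonal change of basis. -/
theorem exists_orthogonal_trace_eq_zero {n m : ℕ} (B : Fin m → Matrix (Fin n) (Fin n) ℂ)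
    (hB : ∀ r, (B r)ᴴ = B r) :
    ∃ O : Matrix (Fin m) (Fin m) ℝ, O * Oᵀ = 1 ∧ ∀ r t, r ≠ t →
      ((∑ s, (O s r : ℂ) • B s) * (∑ s, (O s t : ℂ) • B s)ᴴ).trace = 0 := by
  let G : Matrix (Fin m) (Fin m) ℝ := of fun r s => ((B r * B s).trace).re
  have hG : G.IsHermitian := by
    refine IsHermitian.ext fun r s => ?_
    simp [G, Matrix.trace_mul_comm (B r)]
  have hGc : ∀ r s, (B r * B s).trace = (G r s : ℂ) := by
    intro r s
    refine (Complex.conj_eq_iff_re.1 ?_).symm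
    rw [starRingEnd_apply, ← trace_conjTranspose, conjTranspose_mul, hB, hB, trace_mul_comm]
  let U : Matrix (Fin m) (Fin m) ℝ := hG.eigenvectorUnitary
  have hU : U * Uᵀ = 1 := by
    rw [← conjTranspose_eq_transpose_of_trivial]
    exact Unitary.coe_mul_star_self hG.eigenvectorUnitary
  have hd : Uᵀ * G * U = diagonal hG.eigenvalues := by
    have := hG.conjStarAlgAut_star_eigenvectorUnitary
    rwa [Unitary.conjStarAlgAut_star_apply, star_eq_conjTranspose,
      conjTranspose_eq_transpose_of_trivial] at this
  refine ⟨U, hU, fun r t hrt => ?_⟩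
  have hrt' : (Uᵀ * G * U) r t = 0 := by rw [hd, diagonal_apply_ne _ hrt]
  have htr : ((∑ s, (U s r : ℂ) • B s) * (∑ s, (U s t : ℂ) • B s)ᴴ).trace =
      (((Uᵀ * G * U) r t : ℝ) : ℂ) := by
    simp only [conjTranspose_sum, conjTranspose_smul, hB, Finset.sum_mul, Finset.mul_sum,
      trace_sum, smul_mul_assoc, mul_smul_comm, trace_smul, hGc, Matrix.mul_apply, transpose_apply,
      Complex.ofReal_sum, Complex.ofReal_mul, smul_eq_mul, Complex.star_def, Complex.conj_ofReal]
    refine Finset.sum_congr rfl fun s _ => Finset.sum_congr rfl fun u _ => ?_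
    ring
  rw [htr, hrt', Complex.ofReal_zero]

theorem sum_excess_of_fst_eq {ι : Type*} [Fintype ι] [DecidableEq ι] (l : ι → ℝ) (i : ι)
    (J : Finset ι) (hi : i ∉ J) :
    ∑ j ∈ J, ((l i - l j) ^ 2 - ∑ k, l k ^ 2) ≤ ∑ k, l k ^ 2 := by
  have h1 : l i ^ 2 + ∑ j ∈ J, l j ^ 2 ≤ ∑ k, l k ^ 2 := by
    rw [← Finset.sum_insert (f := fun k => l k ^ 2) hi]
    exact Finset.sum_le_sum_of_subset_of_nonneg (Finset.subset_univ _) fun _ _ _ => sq_nonneg _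
  have h2 := sq_sum_le_card_mul_sum_sq (s := J) (f := l)
  have h3 : ∑ j ∈ J, ((l i - l j) ^ 2 - ∑ k, l k ^ 2) = J.card * l i ^ 2
      - 2 * l i * ∑ j ∈ J, l j + ∑ j ∈ J, l j ^ 2 - J.card * ∑ k, l k ^ 2 := by
    simp only [sub_sq, Finset.sum_sub_distrib, Finset.sum_add_distrib, Finset.mul_sum,
      Finset.sum_const, nsmul_eq_mul]
  rw [h3]
  have h4 : (0 : ℝ) ≤ J.card := Nat.cast_nonneg _
  nlinarith [sq_nonneg (l i + ∑ j ∈ J, l j), mul_le_mul_of_nonneg_left h1 h4]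

/-- The pairs with `(l i - l j) ^ 2 > ∑ l ^ 2` form a star, so the total excess over `∑ l ^ 2` is
at most `∑ l ^ 2`. -/
theorem sum_excess_le {ι : Type*} [Fintype ι] [DecidableEq ι] (l : ι → ℝ) :
    ∑ e : ι × ι, (if l e.2 < l e.1 ∧ ∑ k, l k ^ 2 < (l e.1 - l e.2) ^ 2 then
      (l e.1 - l e.2) ^ 2 - ∑ k, l k ^ 2 else 0) ≤ ∑ k, l k ^ 2 := by
  rw [← Finset.sum_filter]
  set L := ∑ k, l k ^ 2 with hL
  set P := Finset.univ.filter fun e : ι × ι => l e.2 < l e.1 ∧ L < (l e.1 - l e.2) ^ 2 with hP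
  have hL0 : 0 ≤ L := by positivity
  have hpair : ∀ S : Finset ι, ∑ k ∈ S, l k ^ 2 ≤ L := fun S =>
    Finset.sum_le_sum_of_subset_of_nonneg (Finset.subset_univ _) fun _ _ _ => sq_nonneg _
  have hmem : ∀ {i j}, (i, j) ∈ P → l j < l i ∧ L < (l i - l j) ^ 2 := by
    intro i j h; simpa [hP] using h
  have hne : ∀ {i j}, (i, j) ∈ P → i ≠ j := by
    rintro i j h rfl; exact lt_irrefl _ (hmem h).1
  have hsign : ∀ {i j}, (i, j) ∈ P → 0 < l i ∧ l j < 0 := by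
    intro i j h
    have h1 := hpair {i, j}
    rw [Finset.sum_pair (hne h)] at h1
    have h2 := hmem h
    have h3 : l i * l j < 0 := by nlinarith
    constructor <;> nlinarith
  have hmeet : ∀ {i j k t}, (i, j) ∈ P → (k, t) ∈ P → i = k ∨ j = t := by
    intro i j k t h h'
    by_contra! hc
    have a := hsign h
    have b := hsign h'
    have hit : i ≠ t := by rintro rfl; linarith
    have hjk : j ≠ k := by rintro rfl; linarith
    have h1 := hpair {i, j, k, t}
    rw [Finset.sum_insert (by simp [hne h, hc.1, hit]), Finset.sum_insert (by simp [hjk, hc.2]),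
      Finset.sum_pair (hne h')] at h1
    nlinarith [sq_nonneg (l i + l j), sq_nonneg (l k + l t), (hmem h).2, (hmem h').2]
  have hstar : (∃ i, ∀ e ∈ P, e.1 = i) ∨ (∃ j, ∀ e ∈ P, e.2 = j) ∨ P = ∅ := by
    rcases P.eq_empty_or_nonempty with h | ⟨⟨i, j⟩, h⟩
    · exact .inr (.inr h)
    by_contra! hc
    obtain ⟨⟨k, t⟩, hk, hki⟩ := hc.1 i
    obtain ⟨⟨a, b⟩, ha, haj⟩ := hc.2.1 j
    have h1 := hmeet h hk
    have h2 := hmeet h ha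
    have h3 := hmeet hk ha
    grind
  rcases hstar with ⟨i, h⟩ | ⟨j, h⟩ | h
  · have hinj : Set.InjOn Prod.snd (P : Set (ι × ι)) := fun a ha b hb hab =>
      Prod.ext ((h a ha).trans (h b hb).symm) hab
    have := sum_excess_of_fst_eq l i (P.image Prod.snd) (by
      intro hi
      obtain ⟨⟨a, b⟩, ha, rfl⟩ := Finset.mem_image.1 hi
      exact hne ha (h _ ha))
    rw [Finset.sum_image hinj] at this
    refine le_trans (le_of_eq (Finset.sum_congr rfl fun e he => ?_)) this
    rw [h e he]
  · have hinj : Set.InjOn Prod.fst (P : Set (ι × ι)) := fun a ha b hb hab =>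
      Prod.ext hab ((h a ha).trans (h b hb).symm)
    have := sum_excess_of_fst_eq l j (P.image Prod.fst) (by
      intro hi
      obtain ⟨⟨a, b⟩, ha, rfl⟩ := Finset.mem_image.1 hi
      exact hne ha (h _ ha).symm)
    rw [Finset.sum_image hinj] at this
    refine le_trans (le_of_eq (Finset.sum_congr rfl fun e he => ?_)) this
    rw [h e he, ← neg_sub (l j), neg_sq]
  · simpa [h] using hL0

theorem sum_frobSq_mcomm_diagonal_le {n m : ℕ} (l : Fin n → ℝ) (S : Finset (Fin m))
    (X : Fin m → Matrix (Fin n) (Fin n) ℂ) {T : ℝ} (hT0 : 0 ≤ T)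
    (hT : ∀ i j, i ≠ j → 2 * ∑ s ∈ S, ‖X s i j‖ ^ 2 ≤ T) :
    ∑ s ∈ S, frobSq (mcomm (diagonal fun i => (l i : ℂ)) (X s)) ≤
      (∑ k, l k ^ 2) * (∑ s ∈ S, frobSq (X s) + T) := by
  set L := ∑ k, l k ^ 2 with hL
  let w : Fin n × Fin n → ℝ := fun e => ∑ s ∈ S, ‖X s e.1 e.2‖ ^ 2
  let c : Fin n × Fin n → ℝ := fun e => (l e.1 - l e.2) ^ 2 - L
  have hw0 : ∀ e, 0 ≤ w e := fun e => Finset.sum_nonneg fun _ _ => by positivity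
  have hcomm : ∑ s ∈ S, frobSq (mcomm (diagonal fun i => (l i : ℂ)) (X s)) =
      ∑ e, (l e.1 - l e.2) ^ 2 * w e := by
    have : ∀ s i j, ‖mcomm (diagonal fun i => (l i : ℂ)) (X s) i j‖ ^ 2 =
        (l i - l j) ^ 2 * ‖X s i j‖ ^ 2 := by
      intro s i j
      have : mcomm (diagonal fun i => (l i : ℂ)) (X s) i j = ((l i - l j : ℝ) : ℂ) * X s i j := by
        simp [mcomm, diagonal_mul, mul_diagonal]
        ring
      rw [this, norm_mul, mul_pow, Complex.norm_real, Real.norm_eq_abs, sq_abs]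
    simp only [frobSq_eq_sum, this, w, Finset.mul_sum]
    simp only [← Fintype.sum_prod_type']
    rw [Finset.sum_comm]
  have hfrob : ∑ s ∈ S, frobSq (X s) = ∑ e, w e := by
    simp only [frobSq_eq_sum, w, ← Fintype.sum_prod_type']
    rw [Finset.sum_comm]
  have hplus := sum_excess_le l
  have hminus := sum_excess_le fun i => -l i
  simp only [neg_sq, neg_lt_neg_iff, neg_sub_neg, ← hL] at hplus hminus
  have hterm : ∀ e, c e * w e ≤
      ((if l e.2 < l e.1 ∧ L < (l e.1 - l e.2) ^ 2 then (l e.1 - l e.2) ^ 2 - L else 0) +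
      (if l e.1 < l e.2 ∧ L < (l e.2 - l e.1) ^ 2 then (l e.2 - l e.1) ^ 2 - L else 0)) *
      (T / 2) := by
    rintro ⟨i, j⟩
    have hsq : (l j - l i) ^ 2 = (l i - l j) ^ 2 := by ring
    simp only [hsq, c]
    by_cases hc : L < (l i - l j) ^ 2
    · have hl : l i ≠ l j := fun h => by
        rw [h, sub_self] at hc
        have : 0 ≤ L := by positivity
        norm_num at hc
        linarith
      have hwT : w (i, j) ≤ T / 2 := by
        have := hT i j fun h => hl (h ▸ rfl)
        simp only [w]; linarith
      have := mul_le_mul_of_nonneg_left hwT (sub_nonneg.2 hc.le)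
      rcases lt_or_gt_of_ne hl with h | h <;> simpa [h, h.not_gt, hc] using this
    · simpa [hc] using mul_nonpos_of_nonpos_of_nonneg (sub_nonpos.2 (not_lt.1 hc)) (hw0 (i, j))
  have hsum := Finset.sum_le_sum fun e (_ : e ∈ Finset.univ) => hterm e
  rw [← Finset.sum_mul, Finset.sum_add_distrib] at hsum
  have hsplit : ∑ e, (l e.1 - l e.2) ^ 2 * w e = L * ∑ e, w e + ∑ e, c e * w e := by
    rw [Finset.mul_sum, ← Finset.sum_add_distrib]
    exact Finset.sum_congr rfl fun e _ => by simp only [c]; ring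
  rw [hcomm, hfrob, hsplit]
  nlinarith [mul_le_mul_of_nonneg_right (add_le_add hplus hminus) (show 0 ≤ T / 2 by linarith)]

/-- Bessel's inequality for the matrix units. -/
theorem sum_norm_sq_div_frobSq_le_one {n m : ℕ} (S : Finset (Fin m))
    (X : Fin m → Matrix (Fin n) (Fin n) ℂ)
    (hX : ∀ r ∈ S, ∀ t ∈ S, r ≠ t → (X r * (X t)ᴴ).trace = 0) (i j : Fin n) :
    ∑ s ∈ S, ‖X s i j‖ ^ 2 / frobSq (X s) ≤ 1 := by
  set β := ∑ s ∈ S, ‖X s i j‖ ^ 2 / frobSq (X s) with hβ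
  let c : Fin m → ℂ := fun s => star (X s i j) / (frobSq (X s) : ℂ)
  have hβ0 : 0 ≤ β := Finset.sum_nonneg fun s _ => div_nonneg (by positivity) (frobSq_nonneg _)
  have hentry : (∑ s ∈ S, c s • X s) i j = (β : ℂ) := by
    rw [Matrix.sum_apply, hβ, Complex.ofReal_sum]
    refine Finset.sum_congr rfl fun s _ => ?_
    rw [Matrix.smul_apply, smul_eq_mul, div_mul_eq_mul_div, Complex.star_def, Complex.conj_mul']
    push_cast
    rfl
  have hfrob : frobSq (∑ s ∈ S, c s • X s) = β := by
    rw [← Complex.ofReal_inj, ← trace_mul_conjTranspose_self, hβ, Complex.ofReal_sum]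
    simp only [conjTranspose_sum, conjTranspose_smul, Finset.sum_mul, Finset.mul_sum,
      trace_sum, smul_mul_assoc, mul_smul_comm, trace_smul, smul_eq_mul]
    rw [Finset.sum_comm]
    refine Finset.sum_congr rfl fun s hs => ?_
    rw [Finset.sum_eq_single_of_mem s hs fun t ht hts => by
      simp [hX s hs t ht hts.symm], trace_mul_conjTranspose_self]
    rcases eq_or_ne (frobSq (X s)) 0 with h0 | h0
    · simp [h0]
    · have h0' : (frobSq (X s) : ℂ) ≠ 0 := by exact_mod_cast h0
      simp only [c, star_div₀, Complex.star_def, Complex.conj_ofReal]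
      push_cast
      rw [← Complex.conj_mul', Complex.conj_conj]
      field_simp
  have h := norm_sq_le_frobSq (∑ s ∈ S, c s • X s) i j
  rw [hentry, hfrob, Complex.norm_real, Real.norm_eq_abs, sq_abs] at h
  nlinarith

/-- A combination with weights in `[0, 1]` of total at most `2` is bounded by the two largest
terms. -/
theorem sum_mul_le_add {ι : Type*} [DecidableEq ι] (S : Finset ι) (p α : ι → ℝ) {a : ι} {v : ℝ}
    (ha : a ∈ S) (hva : v ≤ p a) (hv0 : 0 ≤ v) (hv : ∀ s ∈ S, s ≠ a → p s ≤ v)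
    (hα0 : ∀ s ∈ S, 0 ≤ α s) (hα1 : α a ≤ 1) (hα2 : ∑ s ∈ S, α s ≤ 2) :
    ∑ s ∈ S, p s * α s ≤ p a + v := by
  rw [← Finset.add_sum_erase _ _ ha] at hα2 ⊢
  have h : ∑ s ∈ S.erase a, p s * α s ≤ v * ∑ s ∈ S.erase a, α s := by
    rw [Finset.mul_sum]
    refine Finset.sum_le_sum fun s hs => ?_
    have hs' := Finset.mem_erase.1 hs
    exact mul_le_mul_of_nonneg_right (hv s hs'.2 hs'.1) (hα0 s hs'.2)
  nlinarith [mul_nonneg (sub_nonneg.2 hva) (sub_nonneg.2 hα1), mul_le_mul_of_nonneg_left hα2 hv0]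

theorem trace_conj_mul_conjTranspose {n : ℕ} {U : Matrix (Fin n) (Fin n) ℂ} (hU : U * Uᴴ = 1)
    (M N : Matrix (Fin n) (Fin n) ℂ) :
    ((Uᴴ * M * U) * (Uᴴ * N * U)ᴴ).trace = (M * Nᴴ).trace := by
  have : (Uᴴ * M * U) * (Uᴴ * N * U)ᴴ = Uᴴ * (M * (U * Uᴴ) * Nᴴ * U) := by
    simp only [conjTranspose_mul, conjTranspose_conjTranspose, Matrix.mul_assoc]
  rw [this, trace_mul_comm, Matrix.mul_assoc, hU, Matrix.mul_one, Matrix.mul_one]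

theorem frobSq_conj {n : ℕ} {U : Matrix (Fin n) (Fin n) ℂ} (hU : U * Uᴴ = 1)
    (M : Matrix (Fin n) (Fin n) ℂ) : frobSq (Uᴴ * M * U) = frobSq M := by
  rw [frobSq, trace_conj_mul_conjTranspose hU, frobSq]

theorem mcomm_conj {n : ℕ} {U : Matrix (Fin n) (Fin n) ℂ} (hU : U * Uᴴ = 1)
    (M N : Matrix (Fin n) (Fin n) ℂ) :
    mcomm (Uᴴ * M * U) (Uᴴ * N * U) = Uᴴ * mcomm M N * U := by
  have h : ∀ P Q : Matrix (Fin n) (Fin n) ℂ,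
      (Uᴴ * P * U) * (Uᴴ * Q * U) = Uᴴ * (P * Q) * U := by
    intro P Q
    calc (Uᴴ * P * U) * (Uᴴ * Q * U) = Uᴴ * P * (U * Uᴴ) * Q * U := by
          simp only [Matrix.mul_assoc]
      _ = _ := by rw [hU]; simp only [Matrix.mul_assoc, Matrix.one_mul]
  rw [mcomm, h, h, mcomm, Matrix.mul_sub, Matrix.sub_mul]

theorem sum_frobSq_mcomm_le {n m : ℕ} {A : Matrix (Fin n) (Fin n) ℂ} (hA : Aᴴ = A)
    (S : Finset (Fin m)) (X : Fin m → Matrix (Fin n) (Fin n) ℂ) (hXh : ∀ s, (X s)ᴴ = X s)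
    (hX : ∀ r ∈ S, ∀ t ∈ S, r ≠ t → (X r * (X t)ᴴ).trace = 0) {a b : Fin m}
    (ha : a ∈ S) (hba : frobSq (X b) ≤ frobSq (X a))
    (hb : ∀ s ∈ S, s ≠ a → frobSq (X s) ≤ frobSq (X b)) :
    ∑ s ∈ S, frobSq (mcomm A (X s)) ≤
      frobSq A * (∑ s ∈ S, frobSq (X s) + (frobSq (X a) + frobSq (X b))) := by
  have hA' : A.IsHermitian := hA
  let U : Matrix (Fin n) (Fin n) ℂ := hA'.eigenvectorUnitary
  have hU : U * Uᴴ = 1 := Unitary.coe_mul_star_self hA'.eigenvectorUnitary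
  have hD : Uᴴ * A * U = diagonal fun i => (hA'.eigenvalues i : ℂ) := by
    have := hA'.conjStarAlgAut_star_eigenvectorUnitary
    rwa [Unitary.conjStarAlgAut_star_apply, star_eq_conjTranspose] at this
  have hAl : frobSq A = ∑ k, hA'.eigenvalues k ^ 2 := by
    rw [← frobSq_conj hU A, hD, frobSq_eq_sum]
    refine Finset.sum_congr rfl fun i _ => ?_
    rw [Finset.sum_eq_single_of_mem i (Finset.mem_univ i) fun j _ hj => by
      simp [diagonal_apply_ne _ hj.symm]]
    simp
  have hYh : ∀ s, (Uᴴ * X s * U)ᴴ = Uᴴ * X s * U := fun s => by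
    simp only [conjTranspose_mul, conjTranspose_conjTranspose, hXh, Matrix.mul_assoc]
  have key := sum_frobSq_mcomm_diagonal_le hA'.eigenvalues S (fun s => Uᴴ * X s * U)
    (T := frobSq (X a) + frobSq (X b)) (add_nonneg (frobSq_nonneg _) (frobSq_nonneg _)) ?_
  · simpa only [← hD, mcomm_conj hU, frobSq_conj hU, ← hAl] using key
  intro i j hij
  set Y : Fin m → Matrix (Fin n) (Fin n) ℂ := fun s => Uᴴ * X s * U with hY
  change 2 * ∑ s ∈ S, ‖Y s i j‖ ^ 2 ≤ _
  have hfY : ∀ s, frobSq (Y s) = frobSq (X s) := fun s => frobSq_conj hU _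
  have hle : ∀ s, 2 * ‖Y s i j‖ ^ 2 ≤ frobSq (X s) := fun s =>
    hfY s ▸ two_mul_norm_sq_le_frobSq (hYh s) hij
  have hbessel := sum_norm_sq_div_frobSq_le_one S Y (fun r hr t ht hrt => by
    rw [hY, trace_conj_mul_conjTranspose hU, hX r hr t ht hrt]) i j
  simp only [hfY] at hbessel
  have := sum_mul_le_add S (fun s => frobSq (X s)) (fun s => 2 * (‖Y s i j‖ ^ 2 / frobSq (X s)))
    ha hba (frobSq_nonneg _) hb
    (fun s _ => mul_nonneg zero_le_two (div_nonneg (by positivity) (frobSq_nonneg _)))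
    (by rw [← mul_div_assoc]; exact div_le_one_of_le₀ (hle a) (frobSq_nonneg _))
    (by rw [← Finset.mul_sum]; linarith)
  refine le_trans (le_of_eq ?_) this
  rw [Finset.mul_sum]
  refine Finset.sum_congr rfl fun s _ => ?_
  rcases eq_or_ne (frobSq (X s)) 0 with h0 | h0
  · have := hle s
    have h1 : 0 ≤ ‖Y s i j‖ ^ 2 := by positivity
    rw [h0] at this ⊢
    linarith
  · field_simp

theorem sum_mul_sum_erase_add_le {m : ℕ} (p : Fin m → ℝ) (c : Fin m → ℝ)
    {i j k : Fin m} (hij : i ≠ j) (hik : i ≠ k) (hjk : j ≠ k)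
    (hci : c i = p j + p k) (hcj : c j = p i + p k)
    (hc : ∀ r, r ≠ i → r ≠ j → c r = p i + p j) :
    ∑ r, p r * (∑ s ∈ Finset.univ.erase r, p s + c r) ≤ 4 / 3 * (∑ r, p r) ^ 2 := by
  set R := (Finset.univ.erase i).erase j with hR
  have hsplit : ∀ f : Fin m → ℝ, ∑ r, f r = f i + f j + ∑ r ∈ R, f r := by
    intro f
    rw [← Finset.add_sum_erase _ _ (Finset.mem_univ i), ← Finset.add_sum_erase _ _
      (show j ∈ Finset.univ.erase i by simp [hij.symm])]
    ring
  have hkR : k ∈ R := by simp [hR, hik.symm, hjk.symm]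
  have h1 : ∑ r, p r * (∑ s ∈ Finset.univ.erase r, p s + c r)
      = (∑ r, p r) ^ 2 - ∑ r, p r ^ 2 + ∑ r, p r * c r := by
    have : ∀ r, ∑ s ∈ Finset.univ.erase r, p s = ∑ s, p s - p r := fun r => by
      rw [← Finset.add_sum_erase _ _ (Finset.mem_univ r)]; ring
    simp only [this, mul_add, mul_sub, Finset.sum_add_distrib, Finset.sum_sub_distrib,
      ← Finset.sum_mul, ← pow_two]
  have h2 : ∑ r ∈ R, p r * c r = (∑ r ∈ R, p r) * (p i + p j) := by
    rw [Finset.sum_mul]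
    refine Finset.sum_congr rfl fun r hr => ?_
    simp only [hR, Finset.mem_erase] at hr
    rw [hc r hr.2.1 hr.1]
  have h3 : p k ^ 2 ≤ ∑ r ∈ R, p r ^ 2 :=
    Finset.single_le_sum (f := fun r => p r ^ 2) (fun _ _ => sq_nonneg _) hkR
  rw [h1, hsplit p, hsplit fun r => p r ^ 2, hsplit fun r => p r * c r, h2, hci, hcj]
  generalize ∑ r ∈ R, p r = t at *
  nlinarith [sq_nonneg (p i - p j), sq_nonneg ((p i + p j - 2 * p k) - (t - p k)),
    sq_nonneg ((p i + p j - 2 * p k) + (t - p k))]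

theorem ddvv_hermitian (n m : ℕ) (hn : 1 ≤ n) (hm : 3 ≤ m)
    (B : Fin m → Matrix (Fin n) (Fin n) ℂ) (hB : ∀ r, (B r)ᴴ = B r) :
    ∑ r : Fin m, ∑ s : Fin m, frobSq (mcomm (B r) (B s)) ≤
      (4 / 3) * (∑ r : Fin m, frobSq (B r)) ^ 2 := by
  obtain ⟨O, hO, horth⟩ := exists_orthogonal_trace_eq_zero B hB
  rw [← sum_frobSq_mcomm_sum_smul hO B, ← sum_frobSq_sum_smul hO B]
  have hCh : ∀ r, (∑ s, (O s r : ℂ) • B s)ᴴ = ∑ s, (O s r : ℂ) • B s := fun r => by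
    simp [conjTranspose_sum, conjTranspose_smul, hB]
  generalize hC : (fun r => ∑ s, (O s r : ℂ) • B s) = C at *
  simp only [funext_iff] at hC
  simp only [hC] at hCh horth ⊢
  let p : Fin m → ℝ := fun r => frobSq (C r)
  obtain ⟨i, -, hi⟩ := Finset.exists_max_image Finset.univ p ⟨⟨0, by omega⟩, Finset.mem_univ _⟩
  obtain ⟨j, hj', hj⟩ := Finset.exists_max_image (Finset.univ.erase i) p
    (Finset.card_pos.1 (by simp; omega))
  obtain ⟨k, hk', hk⟩ := Finset.exists_max_image ((Finset.univ.erase i).erase j) p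
    (Finset.card_pos.1 (by rw [Finset.card_erase_of_mem hj']; simp; omega))
  simp only [Finset.mem_erase, Finset.mem_univ, and_true] at hj' hj hk' hk
  have hji := hi j (Finset.mem_univ j)
  have hkj := hj k hk'.2
  let c : Fin m → ℝ := fun r => if r = i then p j + p k else if r = j then p i + p k else p i + p j
  refine le_trans (Finset.sum_le_sum fun r _ => ?_)
    (sum_mul_sum_erase_add_le p c (Ne.symm hj') (Ne.symm hk'.2)
      (Ne.symm hk'.1) (by simp [c]) (by simp [c, hj'])
      (fun r h1 h2 => by simp [c, h1, h2]))
  have hself : frobSq (mcomm (C r) (C r)) = 0 := by simp [mcomm, frobSq]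
  rw [← Finset.add_sum_erase _ _ (Finset.mem_univ r), hself, zero_add]
  have key := fun {a b : Fin m} => sum_frobSq_mcomm_le (a := a) (b := b) (hCh r)
    (Finset.univ.erase r) C hCh fun _ _ _ _ h => horth _ _ h
  simp only [Finset.mem_erase, Finset.mem_univ, and_true] at key
  by_cases h1 : r = i
  · subst h1
    simpa [c] using key hj' hkj fun s hs hsj => hk s ⟨hsj, hs⟩
  by_cases h2 : r = j
  · subst h2
    simpa [c, h1] using key (Ne.symm h1) (hkj.trans hji) fun s hs hsi => hk s ⟨hs, hsi⟩
  · simpa [c, h1, h2] using key (Ne.symm h1) hji fun s _ hsi => hj s hsi
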